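/- Let M ⊂ ℂⁿ be a subset containing a point p, and let k be a positive integer. If Δ(M_k, p) < k, then Δ(M, p) ≤ k. -/

import Mathlib

open scoped ENNReal Topology

/-- Order of vanishing at `0` of a function `f` between real normed spaces:
the least `m` such that the `m`-th iterated (real) Fréchet derivative of `f` at `0`
is nonzero, and `∞` if all iterated derivatives vanish. -/
noncomputable def vOrder {E F : Type*} [NormedAddCommGroup E] [NormedSpace ℝ E]
    [NormedAddCommGroup F] [NormedSpace ℝ F] (f : E → F) : ℝ≥0∞ :=
  ⨅ m ∈ {m : ℕ | iteratedFDeriv ℝ m f 0 ≠ 0}, (m : ℝ≥0∞)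

/-- `ν(γ)` for a curve `γ : ℂ → ℂⁿ` through `p`: the minimum over the components of
the order of vanishing of `γ i - p i` at `0`. -/
noncomputable def nuCurve {n : ℕ} (γ : ℂ → Fin n → ℂ) (p : Fin n → ℂ) : ℝ≥0∞ :=
  ⨅ i : Fin n, vOrder (fun t => γ t i - p i)

/-- The set `𝒞` of (representatives of) nonconstant germs at `0 ∈ ℂ` of holomorphic
curves `γ` with `γ 0 = p`. -/
def Curves (n : ℕ) (p : Fin n → ℂ) : Set (ℂ → Fin n → ℂ) :=
  {γ | AnalyticAt ℂ γ 0 ∧ γ 0 = p ∧ ¬ (∀ᶠ t in 𝓝 (0 : ℂ), γ t = p)}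

/-- The set `I_M(p)` of (representatives of) germs at `p` of real-valued `C^∞` functions
defined in a neighborhood of `p` and vanishing on `M` near `p`. -/
def IMp (n : ℕ) (M : Set (Fin n → ℂ)) (p : Fin n → ℂ) : Set ((Fin n → ℂ) → ℝ) :=
  {r | ∃ U : Set (Fin n → ℂ), IsOpen U ∧ p ∈ U ∧ ContDiffOn ℝ (⊤ : ℕ∞) r U ∧
    ∀ z ∈ M ∩ U, r z = 0}

/-- The D'Angelo type `Δ(M,p)` of an arbitrary set `M ⊆ ℂⁿ` at `p`:
`Δ(M,p) = sup_{γ ∈ 𝒞} inf_{r ∈ I_M(p)} ν(r∘γ)/ν(γ)`. -/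
noncomputable def Delta (n : ℕ) (M : Set (Fin n → ℂ)) (p : Fin n → ℂ) : ℝ≥0∞ :=
  ⨆ γ ∈ Curves n p, ⨅ r ∈ IMp n M p,
    vOrder (fun t => r (γ t) - r p) / nuCurve γ p

/-- The Taylor polynomial `r_k` of order `k` of `r` at `p`. -/
noncomputable def taylorPoly (n k : ℕ) (r : (Fin n → ℂ) → ℝ) (p : Fin n → ℂ) :
    (Fin n → ℂ) → ℝ :=
  fun z => ∑ j ∈ Finset.range (k + 1),
    ((j.factorial : ℝ))⁻¹ • iteratedFDeriv ℝ j r p (fun _ => z - p)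

/-- `Δ(M_k,p) = sup_{γ ∈ 𝒞} inf_{r ∈ I_M(p)} ν(r_k∘γ)/ν(γ)`. -/
noncomputable def DeltaK (n : ℕ) (M : Set (Fin n → ℂ)) (p : Fin n → ℂ) (k : ℕ) : ℝ≥0∞ :=
  ⨆ γ ∈ Curves n p, ⨅ r ∈ IMp n M p,
    vOrder (fun t => taylorPoly n k r p (γ t) - taylorPoly n k r p p) / nuCurve γ p

section TaylorOrder

variable {E F : Type*} [NormedAddCommGroup E] [NormedSpace ℝ E]
  [NormedAddCommGroup F] [NormedSpace ℝ F]

/-- Multivariate **Taylor theorem** with a big-O remainder. -/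
theorem ContDiffAt.sub_taylor_isBigO [CompleteSpace F] {f : E → F} {x : E} {n : ℕ}
    (hf : ContDiffAt ℝ (n + 1) f x) :
    (fun z => f z - ∑ j ∈ Finset.range (n + 1),
      ((j.factorial : ℝ))⁻¹ • iteratedFDeriv ℝ j f x (fun _ => z - x))
      =O[𝓝 x] fun z => ‖z - x‖ ^ (n + 1) := by
  have hsmooth : ∀ᶠ y in 𝓝 x, ContDiffAt ℝ (n + 1) f y := hf.eventually (by simp)
  have hcont : ContinuousAt (iteratedFDeriv ℝ (n + 1) f) x :=
    hf.continuousAt_iteratedFDeriv (by simp)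
  have hbound : ∀ᶠ y in 𝓝 x,
      ‖iteratedFDeriv ℝ (n + 1) f y‖ < ‖iteratedFDeriv ℝ (n + 1) f x‖ + 1 :=
    hcont.norm.eventually_lt_const (by linarith)
  obtain ⟨ε, hε, hball⟩ := Metric.eventually_nhds_iff_ball.1 (hsmooth.and hbound)
  refine Asymptotics.IsBigO.of_bound
    ((n.factorial : ℝ)⁻¹ * (‖iteratedFDeriv ℝ (n + 1) f x‖ + 1)) ?_
  filter_upwards [Metric.ball_mem_nhds x hε] with z hz
  have hseg : ∀ t ∈ Set.Icc (0 : ℝ) 1, x + t • (z - x) ∈ Metric.ball x ε := fun t ht =>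
    (convex_ball x ε).add_smul_sub_mem (Metric.mem_ball_self hε) hz ht
  have htaylor := map_add_eq_sum_add_integral_iteratedFDeriv (f := f) (x := x) (y := z - x)
    (n := n) fun t ht => (hball _ (hseg t ht)).1
  rw [add_sub_cancel] at htaylor
  rw [htaylor, add_sub_cancel_left, norm_smul, mul_assoc, norm_inv, Real.norm_natCast,
    norm_pow, norm_norm]
  gcongr
  refine (intervalIntegral.norm_integral_le_of_norm_le_const
    (C := (‖iteratedFDeriv ℝ (n + 1) f x‖ + 1) * ‖z - x‖ ^ (n + 1)) fun t ht => ?_).trans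
    (by simp)
  rw [Set.uIoc_of_le zero_le_one] at ht
  have hD := (hball _ (hseg t ⟨ht.1.le, ht.2⟩)).2.le
  rw [norm_smul]
  have hle : ‖(1 - t) ^ n‖ ≤ 1 := by
    rw [norm_pow]
    exact pow_le_one₀ (norm_nonneg _) (abs_le.2 ⟨by linarith [ht.2], by linarith [ht.1]⟩)
  have happ : ‖iteratedFDeriv ℝ (n + 1) f (x + t • (z - x)) fun _ => z - x‖
      ≤ (‖iteratedFDeriv ℝ (n + 1) f x‖ + 1) * ‖z - x‖ ^ (n + 1) := by
    refine (ContinuousMultilinearMap.le_opNorm _ _).trans ?_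
    rw [Finset.prod_const, Finset.card_univ, Fintype.card_fin]
    gcongr
  simpa using mul_le_mul hle happ (norm_nonneg _) zero_le_one

theorem ContDiffAt.isBigO_pow_of_iteratedFDeriv_eq_zero [CompleteSpace F] {f : E → F} {x : E}
    {n : ℕ} (hf : ContDiffAt ℝ n f x) (h : ∀ j < n, iteratedFDeriv ℝ j f x = 0) :
    f =O[𝓝 x] fun z => ‖z - x‖ ^ n := by
  cases n with
  | zero => simpa using (hf.continuousAt.norm.isBoundedUnder_le)
  | succ n =>
    refine (ContDiffAt.sub_taylor_isBigO (n := n) (by exact_mod_cast hf)).congr_left fun z => ?_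
    rw [Finset.sum_eq_zero, sub_zero]
    intro j hj
    simp [h j (Finset.mem_range.1 hj)]

/-- A multilinear map which is symmetric and vanishes on the diagonal is zero. -/
theorem ContinuousMultilinearMap.eq_zero_of_symmetric_of_diagonal {m : ℕ} (φ : E [×m]→L[ℝ] F)
    (hsymm : ∀ (v : Fin m → E) (σ : Equiv.Perm (Fin m)), φ (v ∘ σ) = φ v)
    (hdiag : ∀ y, φ (fun _ => y) = 0) : φ = 0 := by
  ext v
  have h := φ.iteratedFDeriv_comp_diagonal 0 v
  have hsum : ∀ σ : Equiv.Perm (Fin m), φ (fun i => v (σ i)) = φ v := fun σ => hsymm v σ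
  have hcard : ((m.factorial : ℕ) : ℝ) ≠ 0 := by positivity
  simp only [hdiag, hsum, iteratedFDeriv_fun_zero, Finset.sum_const, Finset.card_univ,
    Fintype.card_perm, Fintype.card_fin, Pi.zero_apply, zero_apply] at h
  rw [← Nat.cast_smul_eq_nsmul ℝ] at h
  simpa [hcard] using h.symm

theorem ContDiffAt.iteratedFDeriv_eq_zero_of_isBigO_pow [CompleteSpace F] {f : E → F} {n : ℕ}
    (hf : ContDiffAt ℝ ⊤ f 0) (h : f =O[𝓝 0] fun z => ‖z‖ ^ n) :
    ∀ m < n, iteratedFDeriv ℝ m f 0 = 0 := by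
  intro m
  induction m using Nat.strong_induction_on with
  | _ m ih =>
    intro hm
    refine ContinuousMultilinearMap.eq_zero_of_symmetric_of_diagonal _
      (fun v σ => hf.iteratedFDeriv_comp_perm v σ) ?_
    have hpow : (fun z : E => ‖z‖ ^ n) =O[𝓝 0] fun z => ‖z‖ ^ (m + 1) := by
      refine Asymptotics.IsBigO.of_bound 1 ?_
      filter_upwards [Metric.ball_mem_nhds (0 : E) one_pos] with z hz
      rw [mem_ball_zero_iff] at hz
      simpa using pow_le_pow_of_le_one (norm_nonneg z) hz.le hm
    have htaylor := ContDiffAt.sub_taylor_isBigO (n := m) (hf.of_le le_top)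
    simp only [sub_zero] at htaylor
    have hdiff := (h.trans hpow).sub htaylor
    refine Asymptotics.IsBigO.continuousMultilinearMap_apply_eq_zero ?_
    refine (hdiff.const_smul_left (m.factorial : ℝ)).congr_left fun z => ?_
    have hfac : ((m.factorial : ℕ) : ℝ) ≠ 0 := by positivity
    rw [Pi.smul_apply, sub_sub_cancel, Finset.sum_range_succ, Finset.sum_eq_zero, zero_add,
      smul_inv_smul₀ hfac]
    intro j hj
    have hj := Finset.mem_range.1 hj
    simp [ih j hj (hj.trans hm)]

theorem vOrder_le_of_ne_zero {f : E → F} {m : ℕ} (h : iteratedFDeriv ℝ m f 0 ≠ 0) :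
    vOrder f ≤ m :=
  iInf₂_le m h

theorem iteratedFDeriv_eq_zero_of_lt_vOrder {f : E → F} {m : ℕ} (h : (m : ℝ≥0∞) < vOrder f) :
    iteratedFDeriv ℝ m f 0 = 0 :=
  not_not.1 fun hne => (vOrder_le_of_ne_zero hne).not_gt h

theorem vOrder_lt_iff {f : E → F} {a : ℝ≥0∞} :
    vOrder f < a ↔ ∃ m : ℕ, iteratedFDeriv ℝ m f 0 ≠ 0 ∧ (m : ℝ≥0∞) < a := by
  simp [vOrder, iInf_lt_iff]

theorem exists_nat_eq_vOrder {f : E → F} (h : vOrder f ≠ ⊤) : ∃ m : ℕ, vOrder f = m := by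
  classical
  obtain ⟨m, hm, -⟩ := vOrder_lt_iff.1 h.lt_top
  have hex : ∃ m : ℕ, iteratedFDeriv ℝ m f 0 ≠ 0 := ⟨m, hm⟩
  refine ⟨Nat.find hex, (vOrder_le_of_ne_zero (Nat.find_spec hex)).antisymm ?_⟩
  exact le_iInf₂ fun j hj => by exact_mod_cast Nat.find_min' hex hj

/-- If `g` is real analytic and `f` is smooth, and `f - g` vanishes to order `N`, then every
nonvanishing derivative of `g` of order less than `N` bounds the order of vanishing of `f`. -/
theorem vOrder_le_of_sub_isBigO [CompleteSpace F] {f g : E → F} {N m : ℕ}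
    (hf : ContDiffAt ℝ (⊤ : ℕ∞) f 0) (hg : ContDiffAt ℝ ⊤ g 0)
    (hfg : (fun t => f t - g t) =O[𝓝 0] fun t => ‖t‖ ^ N)
    (hm : iteratedFDeriv ℝ m g 0 ≠ 0) (hmN : m < N) : vOrder f ≤ m := by
  by_contra! hlt
  have hfO : f =O[𝓝 0] fun t => ‖t‖ ^ (m + 1) := by
    have := ContDiffAt.isBigO_pow_of_iteratedFDeriv_eq_zero (n := m + 1)
      (hf.of_le (by exact_mod_cast le_top)) fun j hj =>
        iteratedFDeriv_eq_zero_of_lt_vOrder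
          (lt_of_le_of_lt (by exact_mod_cast Nat.lt_succ_iff.1 hj) hlt)
    simpa using this
  have hpow : (fun z : E => ‖z‖ ^ N) =O[𝓝 0] fun z => ‖z‖ ^ (m + 1) := by
    refine Asymptotics.IsBigO.of_bound 1 ?_
    filter_upwards [Metric.ball_mem_nhds (0 : E) one_pos] with z hz
    rw [mem_ball_zero_iff] at hz
    simpa using pow_le_pow_of_le_one (norm_nonneg z) hz.le hmN
  refine hm (hg.iteratedFDeriv_eq_zero_of_isBigO_pow (n := m + 1) ?_ m (Nat.lt_succ_self m))
  exact (hfO.sub (hfg.trans hpow)).congr_left fun t => by abel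

end TaylorOrder

theorem contDiff_taylorPoly (n k : ℕ) (r : (Fin n → ℂ) → ℝ) (p : Fin n → ℂ) :
    ContDiff ℝ ⊤ (taylorPoly n k r p) := by
  unfold taylorPoly
  refine ContDiff.sum fun j _ => ContDiff.const_smul _ ?_
  exact (iteratedFDeriv ℝ j r p).contDiff.comp
    (contDiff_pi.2 fun _ => contDiff_id.sub contDiff_const)

theorem taylorPoly_self (n k : ℕ) (r : (Fin n → ℂ) → ℝ) (p : Fin n → ℂ) :
    taylorPoly n k r p p = r p := by
  unfold taylorPoly
  rw [Finset.sum_range_succ', Finset.sum_eq_zero]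
  · simp
  · intro j _
    rw [(iteratedFDeriv ℝ (j + 1) r p).map_coord_zero 0 (sub_self p), smul_zero]

theorem nuCurve_ne_zero {n : ℕ} {p : Fin n → ℂ} {γ : ℂ → Fin n → ℂ} (hγ : γ 0 = p) :
    nuCurve γ p ≠ 0 := by
  refine (zero_lt_one.trans_le (le_iInf fun i => le_iInf₂ fun m hm => ?_)).ne'
  rcases Nat.eq_zero_or_pos m with rfl | hpos
  · refine absurd ?_ hm
    ext v
    simp [hγ]
  · exact_mod_cast hpos

theorem exists_nat_eq_nuCurve {n : ℕ} {p : Fin n → ℂ} {γ : ℂ → Fin n → ℂ}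
    (h : nuCurve γ p ≠ ⊤) : ∃ N : ℕ, nuCurve γ p = N := by
  have : Nonempty (Fin n) := by
    by_contra hempty
    rw [not_nonempty_iff] at hempty
    exact h (by simp [nuCurve])
  obtain ⟨i, hi⟩ := exists_eq_ciInf_of_finite (f := fun i => vOrder fun t => γ t i - p i)
  change _ = nuCurve γ p at hi
  rw [← hi] at h ⊢
  exact exists_nat_eq_vOrder h

theorem sub_isBigO_pow_of_nuCurve {n N : ℕ} {p : Fin n → ℂ} {γ : ℂ → Fin n → ℂ}
    (hγ : ContDiffAt ℝ ⊤ γ 0) (hN : nuCurve γ p = N) :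
    (fun t => γ t - p) =O[𝓝 0] fun t => ‖t‖ ^ N := by
  refine Asymptotics.isBigO_pi.2 fun i => ?_
  have hi : ContDiffAt ℝ ⊤ (fun t => γ t i - p i) 0 :=
    (contDiffAt_pi.1 hγ i).sub contDiffAt_const
  have hle : (N : ℝ≥0∞) ≤ vOrder fun t => γ t i - p i := hN ▸ iInf_le _ i
  have := ContDiffAt.isBigO_pow_of_iteratedFDeriv_eq_zero (n := N) (hi.of_le le_top)
    fun j hj => iteratedFDeriv_eq_zero_of_lt_vOrder
      (lt_of_lt_of_le (by exact_mod_cast hj) hle)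
  simpa using this

/-- If `Δ(M_k, p) < k` for some positive integer `k`, then `Δ(M, p) ≤ k`. -/
theorem delta_le_of_deltaK_lt (n : ℕ) (M : Set (Fin n → ℂ)) (p : Fin n → ℂ)
    (hp : p ∈ M) (k : ℕ) (hk : 0 < k) (h : DeltaK n M p k < (k : ℝ≥0∞)) :
    Delta n M p ≤ (k : ℝ≥0∞) := by
  refine iSup₂_le fun γ hγ => ?_
  have hratio : ⨅ r ∈ IMp n M p,
      vOrder (fun t => taylorPoly n k r p (γ t) - taylorPoly n k r p p) / nuCurve γ p < k :=
    lt_of_le_of_lt (le_iSup₂ (f := fun γ (_ : γ ∈ Curves n p) => ⨅ r ∈ IMp n M p,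
      vOrder (fun t => taylorPoly n k r p (γ t) - taylorPoly n k r p p) / nuCurve γ p) γ hγ) h
  simp only [iInf_lt_iff] at hratio
  obtain ⟨r, hr, hlt⟩ := hratio
  refine (iInf₂_le r hr).trans ?_
  obtain ⟨hγan, hγ0, -⟩ := hγ
  rcases eq_or_ne (nuCurve γ p) ⊤ with htop | htop
  · simp [htop]
  have hne := nuCurve_ne_zero hγ0
  obtain ⟨N, hN⟩ := exists_nat_eq_nuCurve htop
  rw [ENNReal.div_lt_iff (.inl hne) (.inl htop), hN, vOrder_lt_iff] at hlt
  obtain ⟨m, hm, hmk⟩ := hlt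
  obtain ⟨U, hU, hpU, hrU, -⟩ := hr
  have hγR : ContDiffAt ℝ ⊤ γ 0 := (hγan.restrictScalars (𝕜 := ℝ)).contDiffAt
  have hrp : ContDiffAt ℝ (⊤ : ℕ∞) r (γ 0) := hγ0 ▸ hrU.contDiffAt (hU.mem_nhds hpU)
  have hγt : Filter.Tendsto γ (𝓝 0) (𝓝 p) := by
    simpa [hγ0] using hγR.continuousAt.tendsto
  have hγO := sub_isBigO_pow_of_nuCurve hγR hN
  have htaylor : (fun z => r z - taylorPoly n k r p z) =O[𝓝 p] fun z => ‖z - p‖ ^ (k + 1) :=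
    ContDiffAt.sub_taylor_isBigO (n := k) ((hγ0 ▸ hrp).of_le (by exact_mod_cast le_top))
  have hdiff := (htaylor.comp_tendsto hγt).trans (hγO.norm_left.pow (k + 1))
  have hle : vOrder (fun t => r (γ t) - r p) ≤ m := by
    refine vOrder_le_of_sub_isBigO (N := N * (k + 1))
      ((hrp.comp 0 (hγR.of_le le_top)).sub contDiffAt_const)
      (((contDiff_taylorPoly n k r p).contDiffAt.comp 0 hγR).sub contDiffAt_const) ?_ hm ?_
    · refine (hdiff.congr_left fun t => ?_).congr_right fun t => (pow_mul _ _ _).symm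
      simp [taylorPoly_self]
    · have : m < k * N := by exact_mod_cast hmk
      nlinarith
  exact ENNReal.div_le_of_le_mul (hle.trans (hN ▸ hmk.le))
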